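/- For every positive integer n and every nonnegative integer k, the number of partitions of n with even mex and exactly k parts greater than 1 equals the number of partitions of n with negative crank and exactly k parts greater than 1. -/

import Mathlib

open scoped Classical

/-- The parts of a partition, sorted in nonincreasing order, so that
`(sortedParts p).getD (i-1) 0` is the `i`-th part `λ_i` (1-indexed). -/
def sortedParts {n : ℕ} (p : n.Partition) : List ℕ :=
  p.parts.sort (· ≥ ·)

/-- The mex of a partition: the smallest positive integer that is not a part. -/
noncomputable def mex {n : ℕ} (p : n.Partition) : ℕ :=
  sInf {m : ℕ | 0 < m ∧ m ∉ p.parts}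

/-- A partition has a fixed point if `λ_i = i` for some index `i`. -/
def hasFixedPoint {n : ℕ} (p : n.Partition) : Prop :=
  ∃ i : ℕ, 0 < i ∧ i ≤ (sortedParts p).length ∧ (sortedParts p).getD (i - 1) 0 = i

/-- `ω(λ)`: the number of parts equal to 1. -/
def omegaStat {n : ℕ} (p : n.Partition) : ℕ := p.parts.count 1

/-- `μ(λ)`: the number of parts greater than `ω(λ)`. -/
def muStat {n : ℕ} (p : n.Partition) : ℕ :=
  (p.parts.filter (fun x => omegaStat p < x)).card

/-- The crank of a partition. -/
def crank {n : ℕ} (p : n.Partition) : ℤ :=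
  if omegaStat p = 0 then (p.parts.sup : ℤ) else (muStat p : ℤ) - (omegaStat p : ℤ)

/-- `β(λ)`: the number of parts greater than 1. -/
def betaStat {n : ℕ} (p : n.Partition) : ℕ :=
  (p.parts.filter (fun x => 1 < x)).card

/-- The Durfee square size: the largest `i` with `λ_i ≥ i` (0 if none). -/
noncomputable def durfee {n : ℕ} (p : n.Partition) : ℕ :=
  sSup {i : ℕ | 0 < i ∧ i ≤ (sortedParts p).length ∧ i ≤ (sortedParts p).getD (i - 1) 0}

/-- Multisets of positive parts with sum `n` and `k` parts bigger than one. -/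
def SS (n k : ℕ) : Set (Multiset ℕ) :=
  {s | 0 ∉ s ∧ s.sum = n ∧ (s.filter (fun x => 1 < x)).card = k}

/-- The first missing value above `j` is at odd distance from `j`. -/
def Mc (j : ℕ) (s : Multiset ℕ) : Prop :=
  ∃ r, Even r ∧ j + 1 + r ∉ s ∧ ∀ i < r, j + 1 + i ∈ s

/-- Shifted negative crank condition. -/
def Cc (j : ℕ) (s : Multiset ℕ) : Prop :=
  (s.filter (fun x => s.count 1 + j < x)).card ≤ s.count 1

/-- Pairs: (antitone sequence of the big parts, number of ones). -/
def TT (n k : ℕ) : Set ((ℕ → ℕ) × ℕ) :=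
  {q | Antitone q.1 ∧ (∀ i < k, 2 ≤ q.1 i) ∧ (∀ i, k ≤ i → q.1 i = 0) ∧
    q.2 + ∑ i ∈ Finset.range k, q.1 i = n}

theorem ncard_partition (n : ℕ) (Q : Multiset ℕ → Prop) :
    {p : Nat.Partition n | Q p.parts}.ncard = {s : Multiset ℕ | 0 ∉ s ∧ s.sum = n ∧ Q s}.ncard := by
  refine Set.ncard_congr (fun p _ => p.parts) ?_ ?_ ?_
  · intro p hp
    exact ⟨fun h => absurd (p.parts_pos h) (lt_irrefl 0), p.parts_sum, hp⟩
  · intro p q _ _ h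
    exact Nat.Partition.ext h
  · rintro s ⟨h0, hs, hQ⟩
    refine ⟨⟨s, fun {i} hi => Nat.pos_of_ne_zero (fun h => h0 (h ▸ hi)), hs⟩, hQ, rfl⟩

theorem SS_finite (n k : ℕ) : (SS n k).Finite := by
  refine (Set.finite_range (fun p : Nat.Partition n => p.parts)).subset ?_
  rintro s ⟨h0, hs, hQ⟩
  exact ⟨⟨s, fun {i} hi => Nat.pos_of_ne_zero (fun h => h0 (h ▸ hi)), hs⟩, rfl⟩

theorem split_card (n k : ℕ) (Q : Multiset ℕ → Prop) :
    {s | s ∈ SS n k ∧ Q s}.ncard + {s | s ∈ SS n k ∧ ¬ Q s}.ncard = (SS n k).ncard := by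
  have h := Set.ncard_inter_add_ncard_sdiff_eq_ncard (SS n k) {s | Q s} (SS_finite n k)
  exact h

theorem exists_missing (s : Multiset ℕ) (j : ℕ) : ∃ r, j + 1 + r ∉ s := by
  refine ⟨s.sum, fun h => ?_⟩
  have := Multiset.le_sum_of_mem h
  omega

theorem not_Mc (j : ℕ) (s : Multiset ℕ) : ¬ Mc j s ↔ (j + 1 ∈ s ∧ Mc (j + 1) s) := by
  constructor
  · intro h
    have hex := exists_missing s j
    have h1 := Nat.find_spec hex
    have h2 : ∀ i < Nat.find hex, j + 1 + i ∈ s := fun i hi => by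
      have := Nat.find_min hex hi
      simpa using this
    generalize Nat.find hex = r at h1 h2
    have hr : ¬ Even r := fun he => h ⟨r, he, h1, h2⟩
    rcases r with _ | r
    · simp at hr
    · refine ⟨by simpa using h2 0 (by omega), r, by simpa [Nat.even_add_one] using hr, ?_, ?_⟩
      · convert h1 using 2; ring
      · intro i hi
        have := h2 (i + 1) (by omega)
        convert this using 1; ring
  · rintro ⟨h0, r', he', h1', h2'⟩ ⟨r, he, h1, h2⟩
    have hr0 : r ≠ 0 := by rintro rfl; exact h1 (by simpa using h0)
    obtain ⟨r, rfl⟩ := Nat.exists_eq_succ_of_ne_zero hr0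
    rcases lt_trichotomy r r' with h | h | h
    · have := h2' r h
      apply h1; convert this using 1; simp; ring
    · subst h
      simp [Nat.even_add_one] at he
      exact absurd he' (by simpa using he)
    · have := h2 (r' + 1) (by simpa using h)
      apply h1'; convert this using 1; ring

theorem Mc_cons (j a : ℕ) (h : a ≤ j) (s : Multiset ℕ) : Mc j (a ::ₘ s) ↔ Mc j s := by
  have : ∀ i, j + 1 + i ∈ a ::ₘ s ↔ j + 1 + i ∈ s := by
    intro i
    rw [Multiset.mem_cons]
    constructor
    · rintro (h | h)
      · omega
      · exact h
    · exact Or.inr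
  simp only [Mc, this]

theorem Mc_step (n k j : ℕ) (hj : 1 ≤ j) :
    {s | s ∈ SS (n + j + 1) (k + 1) ∧ ¬ Mc j s}.ncard = {s | s ∈ SS n k ∧ Mc (j + 1) s}.ncard := by
  symm
  refine Set.ncard_congr (fun s _ => (j + 1) ::ₘ s) ?_ ?_ ?_
  · rintro s ⟨⟨h0, hs, hc⟩, hm⟩
    refine ⟨⟨?_, ?_, ?_⟩, ?_⟩
    · simp [h0]
    · simp [hs]; ring
    · rw [Multiset.filter_cons_of_pos _ (by omega)]; simp [hc]
    · rw [not_Mc, Mc_cons _ _ le_rfl]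
      exact ⟨by simp, hm⟩
  · intro s t _ _ h
    simpa using h
  · rintro s ⟨⟨h0, hs, hc⟩, hm⟩
    rw [not_Mc] at hm
    obtain ⟨h1, hm⟩ := hm
    obtain ⟨t, rfl⟩ := Multiset.exists_cons_of_mem h1
    rw [Mc_cons _ _ le_rfl] at hm
    rw [Multiset.filter_cons_of_pos _ (by omega)] at hc
    refine ⟨t, ⟨⟨?_, ?_, ?_⟩, hm⟩, rfl⟩
    · intro h; exact h0 (by simp [h])
    · simp at hs; omega
    · simpa using hc

theorem Mc_empty (n k j : ℕ) (hj : 1 ≤ j) (h : n < j + 1 ∨ k = 0) :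
    {s | s ∈ SS n k ∧ ¬ Mc j s} = ∅ := by
  rw [Set.eq_empty_iff_forall_notMem]
  rintro s ⟨⟨h0, hs, hc⟩, hm⟩
  rw [not_Mc] at hm
  have h1 := Multiset.le_sum_of_mem hm.1
  rcases h with h | h
  · omega
  · rw [h, Multiset.card_eq_zero, Multiset.filter_eq_nil] at hc
    exact hc _ hm.1 (by omega)

/-- From sequences to multisets. -/
def GG (k : ℕ) (q : (ℕ → ℕ) × ℕ) : Multiset ℕ :=
  Multiset.replicate q.2 1 + ((List.range k).map q.1 : Multiset ℕ)

theorem GG_count {n k : ℕ} {q : (ℕ → ℕ) × ℕ} (hq : q ∈ TT n k) : (GG k q).count 1 = q.2 := by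
  obtain ⟨ha, h2, h0, hs⟩ := hq
  have : List.count 1 (List.map q.1 (List.range k)) = 0 := by
    rw [List.count_eq_zero]
    intro h
    obtain ⟨i, hi, h⟩ := List.mem_map.1 h
    have := h2 i (List.mem_range.1 hi)
    omega
  simp [GG, this]

theorem GG_filter {n k : ℕ} {q : (ℕ → ℕ) × ℕ} (hq : q ∈ TT n k) (m : ℕ) (hm : 1 ≤ m) :
    ((GG k q).filter (fun x => m < x)).card = ((Finset.range k).filter (fun i => m < q.1 i)).card := by
  have h1 : (Multiset.replicate q.2 1).filter (fun x => m < x) = 0 := by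
    rw [Multiset.filter_eq_nil]
    intro a ha
    rw [Multiset.eq_of_mem_replicate ha]; omega
  have h3 : ((List.range k).map q.1 : Multiset ℕ) = (Multiset.range k).map q.1 := rfl
  rw [GG, Multiset.filter_add, h1, zero_add, h3, Multiset.filter_map, Multiset.card_map]
  rfl

theorem GG_Cc {n k : ℕ} {q : (ℕ → ℕ) × ℕ} (hq : q ∈ TT n k) (j : ℕ) (hj : 1 ≤ j) :
    Cc j (GG k q) ↔ q.1 q.2 ≤ q.2 + j := by
  rw [Cc, GG_count hq, GG_filter hq _ (by omega)]
  obtain ⟨ha, h2, h0, hs⟩ := hq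
  constructor
  · intro h
    by_contra! hc
    have hk : q.2 < k := by
      by_contra! hk
      have := h0 _ hk
      omega
    have : Finset.range (q.2 + 1) ⊆ (Finset.range k).filter (fun i => q.2 + j < q.1 i) := by
      intro i hi
      rw [Finset.mem_range] at hi
      have := ha (show i ≤ q.2 by omega)
      simp only [Finset.mem_filter, Finset.mem_range]
      omega
    have := Finset.card_le_card this
    rw [Finset.card_range] at this
    omega
  · intro h
    have : (Finset.range k).filter (fun i => q.2 + j < q.1 i) ⊆ Finset.range q.2 := by
      intro i hi
      simp only [Finset.mem_filter, Finset.mem_range] at hi ⊢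
      by_contra! hc
      have := ha hc
      omega
    simpa using Finset.card_le_card this

theorem GG_bij (n k : ℕ) : Set.BijOn (GG k) (TT n k) (SS n k) := by
  refine ⟨?_, ?_, ?_⟩
  · intro q hq
    refine ⟨?_, ?_, ?_⟩
    · obtain ⟨ha, h2, h0, hs⟩ := hq
      intro h
      rw [GG, Multiset.mem_add] at h
      rcases h with h | h
      · have := Multiset.eq_of_mem_replicate h; omega
      · obtain ⟨i, hi, h⟩ := List.mem_map.1 (Multiset.mem_coe.1 h)
        have := h2 i (List.mem_range.1 hi)
        omega
    · obtain ⟨ha, h2, h0, hs⟩ := hq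
      rw [GG, Multiset.sum_add, Multiset.sum_replicate, Multiset.sum_coe, ← hs]
      simp [Finset.sum, Multiset.range]
    · rw [GG_filter hq 1 le_rfl]
      obtain ⟨ha, h2, h0, hs⟩ := hq
      rw [Finset.filter_true_of_mem, Finset.card_range]
      intro i hi
      exact h2 i (Finset.mem_range.1 hi)
  · intro q hq q' hq' h
    have hw : q.2 = q'.2 := by rw [← GG_count hq, ← GG_count hq', h]
    obtain ⟨ha, h2, h0, hs⟩ := hq
    obtain ⟨ha', h2', h0', hs'⟩ := hq'
    simp only [GG, hw] at h
    have h := add_left_cancel h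
    rw [Multiset.coe_eq_coe] at h
    have key : ∀ g : ℕ → ℕ, Antitone g → ((List.range k).map g).Pairwise (· ≥ ·) := by
      intro g hg
      rw [List.pairwise_map]
      exact List.pairwise_lt_range.imp (fun hab => hg (le_of_lt hab))
    have h := h.eq_of_pairwise (fun a b _ _ h1 h2 => le_antisymm h2 h1) (key _ ha) (key _ ha')
    rw [List.map_inj_left] at h
    refine Prod.ext (funext fun i => ?_) hw
    by_cases hi : i < k
    · exact h i (List.mem_range.2 hi)
    · rw [h0 i (by omega), h0' i (by omega)]
  · rintro s ⟨h0, hs, hc⟩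
    set l := (s.filter (fun x => 1 < x)).sort (· ≥ ·) with hl
    have hlc : (l : Multiset ℕ) = s.filter (fun x => 1 < x) := Multiset.sort_eq _ _
    have hlen : l.length = k := by rw [← hc, ← hlc]; rfl
    have hsorted : l.Pairwise (· ≥ ·) := Multiset.pairwise_sort _ _
    have hmap : (List.range k).map (fun i => l.getD i 0) = l := by
      apply List.ext_getElem
      · simp [hlen]
      · intro i h1 h2
        simp [h2]
    have hG : GG k (fun i => l.getD i 0, s.count 1) = s := by
      rw [GG]
      simp only
      rw [hmap, hlc]
      conv_rhs => rw [← Multiset.filter_add_not (fun x => 1 < x) s]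
      rw [add_comm]
      congr 1
      rw [← Multiset.filter_eq']
      apply Multiset.filter_congr
      intro x hx
      have : x ≠ 0 := fun h => h0 (h ▸ hx)
      omega
    refine ⟨(fun i => l.getD i 0, s.count 1), ⟨?_, ?_, ?_, ?_⟩, hG⟩
    · intro a b hab
      simp only
      by_cases hb : b < l.length
      · rcases hab.eq_or_lt with rfl | hab
        · exact le_rfl
        · have := List.pairwise_iff_getElem.1 hsorted a b (by omega) hb hab
          rw [List.getD_eq_getElem _ _ hb, List.getD_eq_getElem _ _ (by omega)]
          exact this
      · rw [List.getD_eq_default _ _ (by omega)]; exact Nat.zero_le _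
    · intro i hi
      simp only
      rw [List.getD_eq_getElem _ _ (by omega)]
      have : l[i]'(by omega) ∈ (l : Multiset ℕ) := List.getElem_mem _
      rw [hlc] at this
      exact (Multiset.mem_filter.1 this).2
    · intro i hi
      simp only
      exact List.getD_eq_default _ _ (by omega)
    · have := congrArg Multiset.sum hG
      rw [GG, Multiset.sum_add, Multiset.sum_replicate, Multiset.sum_coe, hs] at this
      rw [← this]
      simp [Finset.sum, Multiset.range]

theorem GG_ncard (n k : ℕ) (Q : (ℕ → ℕ) × ℕ → Prop) (R : Multiset ℕ → Prop)
    (h : ∀ q ∈ TT n k, (R (GG k q) ↔ Q q)) :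
    {q | q ∈ TT n k ∧ Q q}.ncard = {s | s ∈ SS n k ∧ R s}.ncard := by
  obtain ⟨h1, h2, h3⟩ := GG_bij n k
  refine Set.ncard_congr (fun q _ => GG k q) ?_ ?_ ?_
  · rintro q ⟨hq, hQ⟩
    exact ⟨h1 hq, (h q hq).2 hQ⟩
  · intro a b ha hb hab
    exact h2 ha.1 hb.1 hab
  · rintro s ⟨hs, hR⟩
    obtain ⟨q, hq, rfl⟩ := h3 hs
    exact ⟨q, ⟨hq, (h q hq).1 hR⟩, rfl⟩

/-- `d` is the least index with `f d ≤ d + j`. -/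
def IsD (j : ℕ) (f : ℕ → ℕ) (d : ℕ) : Prop := f d ≤ d + j ∧ ∀ i < d, i + j < f i

/-- The least index with `f d ≤ d + j`. -/
noncomputable def DD (j : ℕ) (f : ℕ → ℕ) : ℕ := sInf {t | f t ≤ t + j}

theorem DD_eq {j : ℕ} {f : ℕ → ℕ} {d : ℕ} (h : IsD j f d) : DD j f = d := by
  apply le_antisymm
  · exact Nat.sInf_le h.1
  · apply le_csInf ⟨d, h.1⟩
    intro b hb
    by_contra! hc
    have := h.2 b hc
    simp at hb
    omega

theorem DD_spec {n k : ℕ} {q : (ℕ → ℕ) × ℕ} (hq : q ∈ TT n k) (j : ℕ) : IsD j q.1 (DD j q.1) := by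
  obtain ⟨ha, h2, h0, hs⟩ := hq
  refine ⟨Nat.sInf_mem (s := {t | q.1 t ≤ t + j}) ⟨k, ?_⟩, ?_⟩
  · simp [h0 k le_rfl]
  · intro i hi
    have := Nat.notMem_of_lt_sInf hi
    simpa using this

/-- Forward map with parameters. -/
def fw (d c : ℕ) (f : ℕ → ℕ) : ℕ → ℕ := fun i => if i < d then f i - c else f (i + 1)

/-- Backward map with parameters. -/
def bw (d c a : ℕ) (f : ℕ → ℕ) : ℕ → ℕ :=
  fun i => if i < d then f i + c else if i = d then a else f (i - 1)

theorem bw_sum (d c a k : ℕ) (f : ℕ → ℕ) (h : d ≤ k) :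
    ∑ i ∈ Finset.range (k + 1), bw d c a f i = ∑ i ∈ Finset.range k, f i + d * c + a := by
  obtain ⟨r, rfl⟩ := Nat.exists_eq_add_of_le h
  rw [add_assoc, Finset.sum_range_add, Finset.sum_range_succ', Finset.sum_range_add]
  have h1 : ∑ i ∈ Finset.range d, bw d c a f i = ∑ i ∈ Finset.range d, f i + d * c := by
    rw [Finset.sum_congr rfl (g := fun i => f i + c), Finset.sum_add_distrib]
    · simp
    · intro i hi
      simp [bw, Finset.mem_range.1 hi]
  have h2 : ∀ i, bw d c a f (d + (i + 1)) = f (d + i) := by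
    intro i
    have : ¬ (d + (i + 1) < d) := by omega
    have e1 : d + (i + 1) - 1 = d + i := by omega
    simp only [bw, this, if_false, e1]
    simp
  have h3 : bw d c a f (d + 0) = a := by simp [bw]
  rw [h1, h3]
  simp only [h2]
  ring

theorem bw_fw (d c a : ℕ) (f : ℕ → ℕ) (h : ∀ i < d, c ≤ f i) (ha : f d = a) :
    bw d c a (fw d c f) = f := by
  funext i
  rcases lt_trichotomy i d with hi | hi | hi
  · simp [bw, fw, hi, h i hi]
  · simp [bw, hi, ha]
  · have h1 : ¬ i < d := by omega
    have h2 : i ≠ d := by omega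
    have h3 : ¬ i - 1 < d := by omega
    have h4 : i - 1 + 1 = i := by omega
    simp [bw, fw, h1, h2, h3, h4]

theorem fw_bw (d c a : ℕ) (f : ℕ → ℕ) : fw d c (bw d c a f) = f := by
  funext i
  by_cases hi : i < d
  · simp [bw, fw, hi]
  · have h1 : ¬ i + 1 < d := by omega
    have h2 : i + 1 ≠ d := by omega
    simp [bw, fw, hi, h1, h2]

/-- Key parametrised lemma, backwards direction. -/
theorem bw_mem {n k j d c w : ℕ} {f : ℕ → ℕ} (hj : 1 ≤ j) (hw : w ≤ d)
    (hq : (f, d + c * (d + 1) + w) ∈ TT n k) (hd : IsD (j + 1) f d) :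
    (bw d c (d + 1 + j + c) f, w) ∈ TT (n + j + 1) (k + 1) ∧
      IsD j (bw d c (d + 1 + j + c) f) (d + 1) := by
  obtain ⟨ha, h2, h0, hs⟩ := hq
  obtain ⟨hd1, hd2⟩ := hd
  simp only at ha h2 h0 hs
  have hdk : d ≤ k := by
    by_contra! hc
    have := hd2 k hc
    rw [h0 k le_rfl] at this
    omega
  have hlow : ∀ i < d, d + 1 + j ≤ f i := by
    intro i hi
    have := hd2 (d - 1) (by omega)
    have := ha (show i ≤ d - 1 by omega)
    omega
  refine ⟨⟨?_, ?_, ?_, ?_⟩, ?_, ?_⟩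
  · apply antitone_nat_of_succ_le
    intro i
    simp only [bw]
    have e : i + 1 - 1 = i := rfl
    rcases lt_trichotomy i d with hi | hi | hi
    · have := ha (show i ≤ i + 1 by omega)
      have := hlow i hi
      split_ifs <;> omega
    · subst hi
      simp
      omega
    · have := ha (show i - 1 ≤ i by omega)
      split_ifs <;> first | omega | (rw [e]; exact this)
  · intro i hi
    simp only [bw]
    split_ifs with h h'
    · have := h2 i (by omega); omega
    · omega
    · exact h2 _ (by omega)
  · intro i hi
    simp only [bw]
    split_ifs with h h'
    · omega
    · omega
    · exact h0 _ (by omega)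
  · simp only
    rw [bw_sum _ _ _ _ _ hdk, ← hs]
    ring
  · simp [bw]
    omega
  · intro i hi
    simp only [bw]
    split_ifs with h h'
    · have := hlow i h; omega
    · omega
    · omega

/-- Key parametrised lemma, forward direction. -/
theorem fw_mem {n k j d c w : ℕ} {f : ℕ → ℕ} (hj : 1 ≤ j) (hc : f d = d + 1 + j + c)
    (hq : (f, w) ∈ TT (n + j + 1) (k + 1)) (hd : IsD j f (d + 1)) :
    (fw d c f, d + c * (d + 1) + w) ∈ TT n k ∧ IsD (j + 1) (fw d c f) d := by
  obtain ⟨ha, h2, h0, hs⟩ := hq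
  obtain ⟨hd1, hd2⟩ := hd
  simp only at ha h2 h0 hs
  have hdk : d ≤ k := by
    by_contra! hc
    have := h0 d (by omega)
    omega
  have hlow : ∀ i < d, d + 1 + j + c ≤ f i := by
    intro i hi
    have := ha (show i ≤ d by omega)
    omega
  have hb : bw d c (d + 1 + j + c) (fw d c f) = f :=
    bw_fw _ _ _ _ (fun i hi => by have := hlow i hi; omega) hc
  refine ⟨⟨?_, ?_, ?_, ?_⟩, ?_, ?_⟩
  · apply antitone_nat_of_succ_le
    intro i
    have h1 := ha (show i ≤ i + 1 by omega)
    have h2 := ha (show i + 1 ≤ i + 1 + 1 by omega)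
    simp only [fw]
    split_ifs with h h'
    · omega
    · omega
    · have : i + 1 = d := by omega
      have h3 := hlow i (by omega)
      rw [this]; omega
    · exact h2
  · intro i hi
    simp only [fw]
    split_ifs with h
    · have := hlow i h; omega
    · exact h2 _ (by omega)
  · intro i hi
    simp only [fw]
    split_ifs with h
    · omega
    · exact h0 _ (by omega)
  · simp only
    have := bw_sum d c (d + 1 + j + c) k (fw d c f) hdk
    rw [hb] at this
    rw [this] at hs
    have e : c * (d + 1) = d * c + c := by ring
    rw [e]
    omega
  · simp [fw]
    omega
  · intro i hi
    simp only [fw, hi, if_true]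
    have := hlow i hi
    omega

theorem Cc_step_T (n k j : ℕ) (hj : 1 ≤ j) :
    {q | q ∈ TT (n + j + 1) (k + 1) ∧ ¬ q.1 q.2 ≤ q.2 + j}.ncard =
      {q | q ∈ TT n k ∧ q.1 q.2 ≤ q.2 + (j + 1)}.ncard := by
  have main : ∀ q : (ℕ → ℕ) × ℕ, q ∈ TT n k → q.1 q.2 ≤ q.2 + (j + 1) →
      ∃ f d c w, w ≤ d ∧ q = (f, d + c * (d + 1) + w) ∧ IsD (j + 1) f d ∧
        DD (j + 1) q.1 = d ∧ (q.2 - d) / (d + 1) = c ∧ (q.2 - d) % (d + 1) = w := by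
    intro q hq hle
    have hd := DD_spec hq (j + 1)
    set d := DD (j + 1) q.1 with hdd
    have hdw : d ≤ q.2 := by
      by_contra! hc
      have := hd.2 _ hc
      omega
    refine ⟨q.1, d, _, _, ?_, ?_, hd, rfl, rfl, rfl⟩
    · have := Nat.mod_lt (q.2 - d) (show d + 1 > 0 by omega)
      omega
    · refine Prod.ext rfl ?_
      have := Nat.div_add_mod' (q.2 - d) (d + 1)
      simp only
      omega
  symm
  refine Set.ncard_congr (fun q _ =>
    (bw (DD (j + 1) q.1) ((q.2 - DD (j + 1) q.1) / (DD (j + 1) q.1 + 1))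
      (DD (j + 1) q.1 + 1 + j + (q.2 - DD (j + 1) q.1) / (DD (j + 1) q.1 + 1)) q.1,
      (q.2 - DD (j + 1) q.1) % (DD (j + 1) q.1 + 1))) ?_ ?_ ?_
  · rintro q ⟨hq, hle⟩
    obtain ⟨f, d, c, w, hw, rfl, hd, e1, e2, e3⟩ := main q hq hle
    simp only at e1 e2 e3
    simp only [e1, e2, e3]
    obtain ⟨h1, h2⟩ := bw_mem hj hw hq hd
    refine ⟨h1, ?_⟩
    have := h2.2 w (by omega)
    simpa using this
  · rintro q q' ⟨hq, hle⟩ ⟨hq', hle'⟩ h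
    obtain ⟨f, d, c, w, hw, rfl, hd, e1, e2, e3⟩ := main q hq hle
    obtain ⟨f', d', c', w', hw', rfl, hd', e1', e2', e3'⟩ := main q' hq' hle'
    simp only at e1 e2 e3 e1' e2' e3'
    simp only [e1, e2, e3, e1', e2', e3', Prod.mk.injEq] at h
    obtain ⟨h, rfl⟩ := h
    obtain ⟨-, h2⟩ := bw_mem hj hw hq hd
    obtain ⟨-, h2'⟩ := bw_mem hj hw' hq' hd'
    have hdd := DD_eq h2
    rw [h, DD_eq h2'] at hdd
    have : d = d' := by omega
    subst this
    have hc : c = c' := by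
      have := congrFun h d
      simpa [bw] using this
    subst hc
    have := congrArg (fw d c) h
    rw [fw_bw, fw_bw] at this
    rw [this]
  · rintro ⟨f, w⟩ ⟨hq, hgt⟩
    simp only at hgt
    have hd := DD_spec hq j
    simp only at hd
    have hpos : w < DD j f := by
      by_contra! hc
      have := hd.1
      have := hq.1 hc
      simp only at this
      omega
    obtain ⟨d, hdd⟩ : ∃ d, DD j f = d + 1 := ⟨DD j f - 1, by omega⟩
    rw [hdd] at hd hpos
    obtain ⟨c, hc⟩ : ∃ c, f d = d + 1 + j + c := by
      have := hd.2 d (by omega)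
      exact ⟨f d - (d + 1 + j), by omega⟩
    obtain ⟨h1, h2⟩ := fw_mem hj hc hq hd
    have hb : bw d c (d + 1 + j + c) (fw d c f) = f :=
      bw_fw _ _ _ _ (fun i hi => by
        have := hq.1 (show i ≤ d by omega)
        simp only at this
        omega) hc
    refine ⟨(fw d c f, d + c * (d + 1) + w), ⟨h1, ?_⟩, ?_⟩
    · simp only
      have := h1.1 (show d ≤ d + c * (d + 1) + w by rw [add_assoc]; exact Nat.le_add_right _ _)
      have := h2.1
      simp only at *
      generalize c * (d + 1) = z at *
      omega
    · simp only
      rw [DD_eq h2]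
      have e : d + c * (d + 1) + w - d = w + c * (d + 1) := by omega
      have e2 : (w + c * (d + 1)) / (d + 1) = c := by
        rw [Nat.add_mul_div_right _ _ (by omega), Nat.div_eq_of_lt hpos, zero_add]
      have e3 : (w + c * (d + 1)) % (d + 1) = w := by
        rw [Nat.add_mul_mod_self_right, Nat.mod_eq_of_lt hpos]
      rw [e, e2, e3, hb]

theorem Cc_step (n k j : ℕ) (hj : 1 ≤ j) :
    {s | s ∈ SS (n + j + 1) (k + 1) ∧ ¬ Cc j s}.ncard = {s | s ∈ SS n k ∧ Cc (j + 1) s}.ncard := by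
  rw [← GG_ncard (n + j + 1) (k + 1) (fun q => ¬ q.1 q.2 ≤ q.2 + j) (fun s => ¬ Cc j s)
      (fun q hq => not_congr (GG_Cc hq j hj)),
    ← GG_ncard n k (fun q => q.1 q.2 ≤ q.2 + (j + 1)) (fun s => Cc (j + 1) s)
      (fun q hq => GG_Cc hq (j + 1) (by omega))]
  exact Cc_step_T n k j hj

theorem Cc_empty (n k j : ℕ) (hj : 1 ≤ j) (h : n < j + 1 ∨ k = 0) :
    {s | s ∈ SS n k ∧ ¬ Cc j s} = ∅ := by
  rw [Set.eq_empty_iff_forall_notMem]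
  rintro s ⟨⟨h0, hs, hc⟩, hm⟩
  rw [Cc, not_le] at hm
  obtain ⟨x, hx⟩ := Multiset.card_pos_iff_exists_mem.1 (by omega : 0 < (s.filter (fun x => s.count 1 + j < x)).card)
  rw [Multiset.mem_filter] at hx
  have h1 := Multiset.le_sum_of_mem hx.1
  rcases h with h | h
  · omega
  · rw [h, Multiset.card_eq_zero, Multiset.filter_eq_nil] at hc
    exact hc _ hx.1 (by omega)

theorem Mc_eq_Cc (n : ℕ) : ∀ k j : ℕ, 1 ≤ j →
    {s | s ∈ SS n k ∧ Mc j s}.ncard = {s | s ∈ SS n k ∧ Cc j s}.ncard := by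
  induction n using Nat.strong_induction_on with
  | _ n ih =>
    intro k j hj
    have h1 := split_card n k (Mc j)
    have h2 := split_card n k (Cc j)
    suffices h : {s | s ∈ SS n k ∧ ¬ Mc j s}.ncard = {s | s ∈ SS n k ∧ ¬ Cc j s}.ncard by omega
    by_cases hc : n < j + 1 ∨ k = 0
    · rw [Mc_empty n k j hj hc, Cc_empty n k j hj hc]
    · push Not at hc
      obtain ⟨m, rfl⟩ : ∃ m, n = m + j + 1 := ⟨n - j - 1, by omega⟩
      obtain ⟨k, rfl⟩ := Nat.exists_eq_succ_of_ne_zero hc.2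
      rw [Nat.succ_eq_add_one, Mc_step m k j hj, Cc_step m k j hj]
      exact ih m (by omega) k (j + 1) (by omega)

/-- Adding a part equal to one. -/
theorem cons_one_ncard (n k : ℕ) (Q R : Multiset ℕ → Prop) (h1 : ∀ s, 0 ∉ s → Q s → 1 ∈ s)
    (h2 : ∀ s, 0 ∉ s → (Q (1 ::ₘ s) ↔ R s)) :
    {s : Multiset ℕ | 0 ∉ s ∧ s.sum = n + 1 ∧ Q s ∧ (s.filter (fun x => 1 < x)).card = k}.ncard
      = {s | s ∈ SS n k ∧ R s}.ncard := by
  symm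
  refine Set.ncard_congr (fun s _ => 1 ::ₘ s) ?_ ?_ ?_
  · rintro s ⟨⟨h0, hs, hc⟩, hR⟩
    refine ⟨by simp [h0], by simp [hs]; ring, (h2 s h0).2 hR, ?_⟩
    rw [Multiset.filter_cons_of_neg _ (by omega), hc]
  · intro s t _ _ h
    simpa using h
  · rintro s ⟨h0, hs, hQ, hc⟩
    obtain ⟨t, rfl⟩ := Multiset.exists_cons_of_mem (h1 s h0 hQ)
    have h0' : 0 ∉ t := fun h => h0 (by simp [h])
    rw [Multiset.filter_cons_of_neg _ (by omega)] at hc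
    exact ⟨t, ⟨⟨h0', by simp at hs; omega, hc⟩, (h2 t h0').1 hQ⟩, rfl⟩

theorem even_mex_iff (s : Multiset ℕ) :
    Even (sInf {m : ℕ | 0 < m ∧ m ∉ s}) ↔ 1 ∈ s ∧ Mc 1 s := by
  rw [← not_Mc 0 s]
  have hne : {m : ℕ | 0 < m ∧ m ∉ s}.Nonempty := by
    obtain ⟨r, hr⟩ := exists_missing s 0
    exact ⟨_, by omega, hr⟩
  have h1 := Nat.sInf_mem hne
  have h2 : ∀ i < sInf {m : ℕ | 0 < m ∧ m ∉ s}, 0 < i → i ∈ s := by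
    intro i hi hp
    have := Nat.notMem_of_lt_sInf hi
    simpa [hp] using this
  generalize sInf {m : ℕ | 0 < m ∧ m ∉ s} = m at h1 h2
  obtain ⟨hm, hms⟩ := h1
  obtain ⟨m, rfl⟩ := Nat.exists_eq_succ_of_ne_zero hm.ne'
  constructor
  · rintro he ⟨r, hr, hr1, hr2⟩
    rcases lt_trichotomy r m with h | h | h
    · exact hr1 (h2 _ (by omega) (by omega))
    · subst h
      simp [Nat.even_add_one] at he
      exact absurd hr (by simpa using he)
    · apply hms; have := hr2 m h
      convert this using 1; simp; ring
  · intro h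
    by_contra hc
    apply h
    refine ⟨m, ?_, ?_, ?_⟩
    · simpa [Nat.even_add_one] using hc
    · convert hms using 2; simp; ring
    · intro i hi
      exact h2 _ (by omega) (by omega)

theorem even_mex_eq_neg_crank (n k : ℕ) (hn : 0 < n) :
    {p : Nat.Partition n | Even (mex p) ∧ betaStat p = k}.ncard = {p : Nat.Partition n | crank p < 0 ∧ betaStat p = k}.ncard := by
  obtain ⟨n, rfl⟩ := Nat.exists_eq_succ_of_ne_zero hn.ne'
  have hA := ncard_partition (n + 1) (fun s =>
    Even (sInf {m : ℕ | 0 < m ∧ m ∉ s}) ∧ (s.filter (fun x => 1 < x)).card = k)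
  have hB := ncard_partition (n + 1) (fun s =>
    (if s.count 1 = 0 then (s.sup : ℤ) else
      ((s.filter (fun x => s.count 1 < x)).card : ℤ) - (s.count 1 : ℤ)) < 0 ∧
      (s.filter (fun x => 1 < x)).card = k)
  refine hA.trans (Eq.trans ?_ hB.symm)
  rw [cons_one_ncard n k (fun s => Even (sInf {m : ℕ | 0 < m ∧ m ∉ s})) (Mc 1),
    cons_one_ncard n k (fun s => (if s.count 1 = 0 then (s.sup : ℤ) else
      ((s.filter (fun x => s.count 1 < x)).card : ℤ) - (s.count 1 : ℤ)) < 0) (Cc 1)]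
  · exact Mc_eq_Cc n k 1 le_rfl
  · intro s _ h
    by_contra hc
    rw [if_pos (Multiset.count_eq_zero.2 hc)] at h
    omega
  · intro s _
    rw [Multiset.count_cons_self, if_neg (by omega),
      Multiset.filter_cons_of_neg _ (by omega), Cc]
    omega
  · intro s _ h
    exact ((even_mex_iff s).1 h).1
  · intro s _
    rw [even_mex_iff, Mc_cons _ _ le_rfl]
    simp
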